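/- Let 0 < α < 1, 1 ≤ p < n/α and 1/q = 1/p − α/n, and suppose there is a constant M such that ‖[b,T]f‖_{L^{q,∞}} ≤ M ‖f‖_{L^p} for every bounded measurable complex-valued function f supported in a cube. Then sup_Q |Q|^{−(1+α/n)} ∫_Q |b(x) − b_Q| dx ≤ C M with C depending only on n, α, p and Ω; consequently b agrees almost everywhere with a function in Lip_α whose seminorm is at most C′ M. -/

import Mathlib

open MeasureTheory ENNReal

noncomputable section

/-- `ℝⁿ` with the Euclidean norm. -/
abbrev En (n : ℕ) := EuclideanSpace ℝ (Fin n)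

/-- The open cube in `ℝⁿ` centered at `c` with half side length `r`. -/
def cube {n : ℕ} (c : En n) (r : ℝ) : Set (En n) := {y | ∀ i, |y i - c i| < r}

/-- Morrey norm `‖f‖_{M^p_q}`. -/
def morreyNorm {n : ℕ} (p q : ℝ) (f : En n → ℂ) : ℝ≥0∞ :=
  ⨆ (c : En n) (r : ℝ) (_ : 0 < r),
    volume (cube c r) ^ (1 / p - 1 / q) *
      (∫⁻ y in cube c r, (‖f y‖₊ : ℝ≥0∞) ^ q) ^ (1 / q)

/-- Weak Morrey norm `‖f‖_{WM^p_q}`. -/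
def weakMorreyNorm {n : ℕ} (p q : ℝ) (f : En n → ℂ) : ℝ≥0∞ :=
  ⨆ (c : En n) (r : ℝ) (_ : 0 < r),
    volume (cube c r) ^ (1 / p - 1 / q) *
      ⨆ (t : ℝ) (_ : 0 < t),
        (ENNReal.ofReal t ^ q * volume {y ∈ cube c r | t < ‖f y‖}) ^ (1 / q)

/-- Weak Lebesgue quasinorm `‖f‖_{L^{p,∞}}`. -/
def weakLpNorm {n : ℕ} (p : ℝ) (f : En n → ℂ) : ℝ≥0∞ :=
  ⨆ (t : ℝ) (_ : 0 < t),
    ENNReal.ofReal t * volume {x : En n | t < ‖f x‖} ^ (1 / p)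

/-- The average `b_Q` of `b` over the cube `Q = cube c r`. -/
def cubeAvg {n : ℕ} (b : En n → ℝ) (c : En n) (r : ℝ) : ℝ :=
  (∫ x in cube c r, b x) / (volume (cube c r)).toReal

/-- The BMO seminorm `‖b‖_*`. -/
def bmoSeminorm {n : ℕ} (b : En n → ℝ) : ℝ≥0∞ :=
  ⨆ (c : En n) (r : ℝ) (_ : 0 < r),
    (volume (cube c r))⁻¹ *
      ∫⁻ x in cube c r, (‖b x - cubeAvg b c r‖₊ : ℝ≥0∞)

/-- The Lipschitz (Hölder) seminorm `‖b‖_{Lip_α}`. -/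
def lipSeminorm {n : ℕ} (α : ℝ) (b : En n → ℝ) : ℝ≥0∞ :=
  ⨆ (x : En n) (y : En n) (_ : x ≠ y),
    (‖b x - b y‖₊ : ℝ≥0∞) / edist x y ^ α

/-- `sup_Q |Q|^{-(1+α/n)} ∫_Q |b - b_Q|`. -/
def lipAvgNorm {n : ℕ} (α : ℝ) (b : En n → ℝ) : ℝ≥0∞ :=
  ⨆ (c : En n) (r : ℝ) (_ : 0 < r),
    volume (cube c r) ^ (-(1 + α / (n : ℝ))) *
      ∫⁻ x in cube c r, (‖b x - cubeAvg b c r‖₊ : ℝ≥0∞)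



open Set Filter Topology

theorem aux_volume_cube {n : ℕ} (c : En n) {r : ℝ} (hr : 0 < r) :
    volume (cube c r) = ENNReal.ofReal ((2 * r) ^ n) := by
  have h := (PiLp.volume_preserving_toLp (Fin n)).measure_preimage_equiv
    (f := MeasurableEquiv.toLp 2 (Fin n → ℝ)) (cube c r)
  rw [← h]
  have : (MeasurableEquiv.toLp 2 (Fin n → ℝ)) ⁻¹' (cube c r) = Metric.ball (c : Fin n → ℝ) r := by
    ext y
    simp [cube, dist_pi_lt_iff hr, Real.dist_eq]
  rw [this, Real.volume_pi_ball _ hr]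
  simp

theorem aux_isOpen_cube {n : ℕ} (c : En n) (r : ℝ) : IsOpen (cube c r) := by
  have : cube c r = ⋂ i, {y : En n | |y i - c i| < r} := by
    ext y; simp [cube]
  rw [this]
  refine isOpen_iInter_of_finite fun i => ?_
  exact isOpen_lt (by fun_prop) continuous_const

theorem aux_measurableSet_cube {n : ℕ} (c : En n) (r : ℝ) : MeasurableSet (cube c r) :=
  (aux_isOpen_cube c r).measurableSet

def ccube {n : ℕ} (c : En n) (r : ℝ) : Set (En n) := {y | ∀ i, |y i - c i| ≤ r}

theorem aux_isClosed_ccube {n : ℕ} (c : En n) (r : ℝ) : IsClosed (ccube c r) := by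
  have : ccube c r = ⋂ i, {y : En n | |y i - c i| ≤ r} := by
    ext y; simp [ccube]
  rw [this]
  refine isClosed_iInter fun i => ?_
  exact isClosed_le (by fun_prop) continuous_const

theorem aux_cube_subset_ccube {n : ℕ} (c : En n) (r : ℝ) : cube c r ⊆ ccube c r :=
  fun _ hy i => (hy i).le

theorem aux_norm_le {n : ℕ} (w : En n) {a : ℝ} (h : ∀ i, |w i| ≤ a) : ‖w‖ ≤ n * a := by
  have h1 : w = ∑ i, w i • EuclideanSpace.single i (1 : ℝ) := by
    ext j
    simp [Pi.single_apply]
  calc ‖w‖ = ‖∑ i, w i • EuclideanSpace.single i (1 : ℝ)‖ := by rw [← h1]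
    _ ≤ ∑ i, ‖w i • EuclideanSpace.single i (1 : ℝ)‖ := norm_sum_le _ _
    _ ≤ ∑ _i : Fin n, a := by
        refine Finset.sum_le_sum fun i _ => ?_
        rw [norm_smul]; simpa using h i
    _ = n * a := by simp

theorem aux_isCompact_ccube {n : ℕ} (c : En n) (r : ℝ) : IsCompact (ccube c r) := by
  refine Metric.isCompact_of_isClosed_isBounded (aux_isClosed_ccube c r) ?_
  refine (Metric.isBounded_iff_subset_closedBall c).2 ⟨n * r, fun y hy => ?_⟩
  rw [Metric.mem_closedBall, dist_eq_norm]
  exact aux_norm_le _ (fun i => by simpa using hy i)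

theorem aux_abs_le {n : ℕ} (w : En n) (i : Fin n) : |w i| ≤ ‖w‖ := by
  simpa using PiLp.norm_apply_le w i

theorem aux_median (ν : Measure ℝ) [IsFiniteMeasure ν] (h0 : ν univ ≠ 0) :
    ∃ m : ℝ, ν univ / 2 ≤ ν (Iic m) ∧ ν univ / 2 ≤ ν (Ici m) := by
  have hfin : ν univ ≠ ∞ := measure_ne_top _ _
  have hhalf : ν univ / 2 < ν univ := ENNReal.half_lt_self h0 hfin
  have hpos : 0 < ν univ / 2 := ENNReal.half_pos h0
  set S : Set ℝ := {t | ν univ / 2 ≤ ν (Iic t)} with hS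
  have hne : S.Nonempty := by
    obtain ⟨t, ht⟩ := ((tendsto_measure_Iic_atTop ν).eventually (lt_mem_nhds hhalf)).exists
    exact ⟨t, ht.le⟩
  have hup : ∀ s ∈ S, ∀ t, s ≤ t → t ∈ S := fun s hs t hst =>
    le_trans hs (measure_mono (Iic_subset_Iic.2 hst))
  have hcompl : ∀ t, t ∉ S → ν univ / 2 ≤ ν (Ioi t) := by
    intro t ht
    have ht' : ν (Iic t) < ν univ / 2 := not_le.1 ht
    have h1 : ν univ ≤ ν (Iic t) + ν (Ioi t) := by
      rw [← Iic_union_Ioi (a := t)]; exact measure_union_le _ _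
    by_contra hcon
    push Not at hcon
    have := ENNReal.add_lt_add ht' hcon
    rw [ENNReal.add_halves] at this
    exact absurd h1 (not_le.2 this)
  have hbdd : BddBelow S := by
    have h4 : Tendsto (fun x => ν (Iic x)) atBot (𝓝 0) := by
      have := tendsto_measure_iInter_atBot (μ := ν) (s := fun x : ℝ => Iic x)
        (fun _ => measurableSet_Iic.nullMeasurableSet) (monotone_Iic) ⟨0, measure_ne_top _ _⟩
      have he : (⋂ x : ℝ, Iic x) = ∅ := by
        ext y; simp only [mem_iInter, mem_Iic, mem_empty_iff_false, iff_false, not_forall, not_le]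
        exact ⟨y - 1, by linarith⟩
      rw [he, measure_empty] at this; exact this
    obtain ⟨s, hs⟩ := (h4.eventually (gt_mem_nhds hpos)).exists
    refine ⟨s, fun x hx => ?_⟩
    by_contra hcon
    push Not at hcon
    exact absurd (hup x hx s hcon.le) (not_le.2 hs)
  obtain ⟨u, hu, hulim⟩ : ∃ u : ℕ → ℝ, (∀ k, 0 < u k) ∧ Antitone u ∧ Tendsto u atTop (𝓝 0) :=
    ⟨fun k => 1 / ((k : ℝ) + 1), fun k => by positivity,
      fun a b hab => one_div_le_one_div_of_le (by positivity) (by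
        have : (a : ℝ) ≤ b := by exact_mod_cast hab
        linarith),
      tendsto_one_div_add_atTop_nhds_zero_nat⟩
  obtain ⟨hanti, hulim⟩ := hulim
  refine ⟨sInf S, ?_, ?_⟩
  · have h1 := tendsto_measure_iInter_atTop (μ := ν) (s := fun k => Iic (sInf S + u k))
        (fun _ => measurableSet_Iic.nullMeasurableSet)
        (fun a b hab => Iic_subset_Iic.2 (by linarith [hanti hab])) ⟨0, measure_ne_top _ _⟩
    have he : (⋂ k, Iic (sInf S + u k)) = Iic (sInf S) := by
      ext y; simp only [mem_iInter, mem_Iic]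
      constructor
      · intro h
        refine ge_of_tendsto' (f := fun k => sInf S + u k) (x := atTop) ?_ h
        simpa using hulim.const_add (sInf S)
      · intro h k; linarith [hu k]
    rw [he] at h1
    refine ge_of_tendsto' h1 fun k => ?_
    obtain ⟨s, hs, hs'⟩ := exists_lt_of_csInf_lt hne (show sInf S < sInf S + u k by linarith [hu k])
    exact hup s hs _ hs'.le
  · have h1 := tendsto_measure_iInter_atTop (μ := ν) (s := fun k => Ioi (sInf S - u k))
        (fun _ => measurableSet_Ioi.nullMeasurableSet)
        (fun a b hab => Ioi_subset_Ioi (by linarith [hanti hab])) ⟨0, measure_ne_top _ _⟩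
    have he : (⋂ k, Ioi (sInf S - u k)) = Ici (sInf S) := by
      ext y; simp only [mem_iInter, mem_Ioi, mem_Ici]
      constructor
      · intro h
        refine le_of_tendsto' (f := fun k => sInf S - u k) (x := atTop) ?_ (fun k => (h k).le)
        simpa using hulim.const_sub (sInf S)
      · intro h k; linarith [hu k]
    rw [he] at h1
    refine ge_of_tendsto' h1 fun k => hcompl _ fun hk => ?_
    have := csInf_le hbdd hk
    linarith [hu k]

theorem aux_kolmogorov {X : Type*} [MeasurableSpace X] (μ : Measure X) (g : X → ℝ)
    (hg0 : ∀ x, 0 ≤ g x) (hg : AEMeasurable g μ) (q N v : ℝ) (hq : 1 < q) (hN : 0 ≤ N) (hv : 0 < v)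
    (hμ : μ univ ≤ ENNReal.ofReal v)
    (h : ∀ t : ℝ, 0 < t → ENNReal.ofReal t * μ {x | t < g x} ^ (1 / q) ≤ ENNReal.ofReal N) :
    ∫⁻ x, ENNReal.ofReal (g x) ∂μ ≤ ENNReal.ofReal (q / (q - 1) * N * v ^ (1 - 1 / q)) := by
  have hq0 : 0 < q := by linarith
  rw [lintegral_eq_lintegral_meas_lt μ (Eventually.of_forall hg0) hg]
  have hb : ∀ t : ℝ, 0 < t → μ {x | t < g x} ≤ ENNReal.ofReal (N ^ q * t ^ (-q)) := by
    intro t ht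
    have h1 : μ {x | t < g x} ^ (1 / q) ≤ ENNReal.ofReal (N / t) := by
      rw [ENNReal.ofReal_div_of_pos ht, ENNReal.le_div_iff_mul_le]
      · rw [mul_comm]; exact h t ht
      · left; simpa using ht
      · left; simp
    have h2 := ENNReal.rpow_le_rpow h1 hq0.le
    rw [← ENNReal.rpow_mul, one_div, inv_mul_cancel₀ hq0.ne', ENNReal.rpow_one,
      ENNReal.ofReal_rpow_of_nonneg (by positivity) hq0.le, Real.div_rpow hN ht.le, div_eq_mul_inv,
      ← Real.rpow_neg ht.le] at h2
    exact h2
  rcases hN.eq_or_lt with hN' | hN'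
  · refine le_trans (le_of_eq ?_) zero_le
    rw [setLIntegral_congr_fun measurableSet_Ioi (g := fun _ => 0)]
    · simp
    · intro t ht
      have := hb t ht
      rw [← hN', Real.zero_rpow hq0.ne'] at this
      simpa using this
  set t0 : ℝ := N * v ^ (-(1 / q)) with ht0
  have ht0pos : 0 < t0 := by positivity
  have hsplit : Ioi (0 : ℝ) = Ioc 0 t0 ∪ Ioi t0 := (Ioc_union_Ioi_eq_Ioi ht0pos.le).symm
  have hA : ∫⁻ t in Ioc 0 t0, μ {x | t < g x} ≤ ENNReal.ofReal (v * t0) := by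
    calc ∫⁻ t in Ioc 0 t0, μ {x | t < g x} ≤ ∫⁻ t in Ioc 0 t0, ENNReal.ofReal v :=
          lintegral_mono fun t => (measure_mono (subset_univ _)).trans hμ
      _ = ENNReal.ofReal (v * t0) := by
          rw [setLIntegral_const, Real.volume_Ioc, sub_zero, ENNReal.ofReal_mul hv.le]
  have hB : ∫⁻ t in Ioi t0, μ {x | t < g x} ≤
      ENNReal.ofReal (N ^ q * (t0 ^ (1 - q) / (q - 1))) := by
    calc ∫⁻ t in Ioi t0, μ {x | t < g x} ≤ ∫⁻ t in Ioi t0, ENNReal.ofReal (N ^ q * t ^ (-q)) :=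
          setLIntegral_mono' measurableSet_Ioi fun t ht => hb t (ht0pos.trans ht)
      _ = ENNReal.ofReal (∫ t in Ioi t0, N ^ q * t ^ (-q)) := by
          rw [ofReal_integral_eq_lintegral_ofReal]
          · exact (integrableOn_Ioi_rpow_of_lt (by linarith) ht0pos).const_mul _
          · filter_upwards [ae_restrict_mem measurableSet_Ioi] with t ht
            have : 0 < t := ht0pos.trans ht
            positivity
      _ = _ := by
          rw [integral_const_mul, integral_Ioi_rpow_of_lt (by linarith) ht0pos]
          congr 2
          rw [show -q + 1 = -(q - 1) by ring, show 1 - q = -(q - 1) by ring, neg_div_neg_eq]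
  calc ∫⁻ t in Ioi 0, μ {x | t < g x} ≤ _ := by rw [hsplit]; exact lintegral_union_le _ _ _
    _ ≤ ENNReal.ofReal (v * t0) + ENNReal.ofReal (N ^ q * (t0 ^ (1 - q) / (q - 1))) :=
        add_le_add hA hB
    _ = ENNReal.ofReal (v * t0 + N ^ q * (t0 ^ (1 - q) / (q - 1))) := by
        rw [ENNReal.ofReal_add]
        · positivity
        · have : 0 < q - 1 := by linarith
          positivity
    _ = _ := by
        congr 1
        have e1 : v * t0 = N * v ^ (1 - 1 / q) := by
          rw [ht0, sub_eq_add_neg, Real.rpow_add hv, Real.rpow_one]; ring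
        have e2 : N ^ q * t0 ^ (1 - q) = N * v ^ (1 - 1 / q) := by
          rw [ht0, Real.mul_rpow hN (by positivity), ← Real.rpow_mul hv.le, ← mul_assoc,
            ← Real.rpow_add hN', show q + (1 - q) = 1 by ring, Real.rpow_one]
          congr 2
          field_simp
          ring
        rw [e1, ← mul_div_assoc, e2]
        have : q - 1 ≠ 0 := by linarith
        field_simp
        ring

theorem aux_kernel (n : ℕ) (hn : 0 < n) (Ω : En n → ℝ)
    (hΩhom : ∀ l : ℝ, 0 < l → ∀ x : En n, x ≠ 0 → Ω (l • x) = Ω x)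
    (hΩc : ContinuousOn Ω {(0 : En n)}ᶜ)
    (hΩne : ∃ x : En n, x ≠ 0 ∧ Ω x ≠ 0) :
    ∃ (u : En n) (c0 ε : ℝ), 0 < c0 ∧ |ε| = 1 ∧ ∀ (c : En n) (r : ℝ), 0 < r →
      ∀ x ∈ cube c r, ∀ y ∈ ccube (c - r • u) r,
        c0 / r ^ n ≤ ε * (Ω (x - y) / ‖x - y‖ ^ n) := by
  obtain ⟨u0, hu0, hΩu0⟩ := hΩne
  have hcont : ContinuousAt Ω u0 := hΩc.continuousAt (isOpen_compl_singleton.mem_nhds hu0)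
  have hpos : 0 < |Ω u0| := abs_pos.2 hΩu0
  have hnu : 0 < ‖u0‖ := norm_pos_iff.2 hu0
  obtain ⟨δ, hδ, hδΩ⟩ := Metric.continuousAt_iff.1 hcont (|Ω u0| / 2) (by positivity)
  set η := min δ ‖u0‖ with hη
  have hηpos : 0 < η := lt_min hδ hnu
  set A : ℝ := (2 * n + 1) / η with hA
  have hApos : 0 < A := by positivity
  obtain ⟨ε, hε, hεΩ⟩ : ∃ ε : ℝ, |ε| = 1 ∧ ε * Ω u0 = |Ω u0| := by
    rcases lt_or_gt_of_ne hΩu0 with h | h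
    · exact ⟨-1, by simp, by rw [abs_of_neg h]; ring⟩
    · exact ⟨1, by simp, by rw [abs_of_pos h]; ring⟩
  refine ⟨A • u0, (|Ω u0| / 2) / (A * (2 * ‖u0‖)) ^ n, ε, by positivity, hε, ?_⟩
  intro c r hr x hx y hy
  set z : En n := (r * A)⁻¹ • (x - y) with hz
  have hrA : 0 < r * A := by positivity
  have hxy : x - y = (r * A) • z := by
    rw [hz, smul_smul, mul_inv_cancel₀ hrA.ne', one_smul]
  have hw : ‖x - y - (r * A) • u0‖ ≤ n * (2 * r) := by
    apply aux_norm_le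
    intro i
    have h1 := hx i
    have h2 := hy i
    simp only [PiLp.sub_apply, PiLp.smul_apply, smul_eq_mul] at h1 h2 ⊢
    rw [abs_lt] at h1
    rw [abs_le] at h2 ⊢
    constructor <;> nlinarith
  have hzu : ‖z - u0‖ < η := by
    have : z - u0 = (r * A)⁻¹ • (x - y - (r * A) • u0) := by
      rw [smul_sub, smul_smul, inv_mul_cancel₀ hrA.ne', one_smul]
    rw [this, norm_smul, Real.norm_of_nonneg (by positivity)]
    rw [inv_mul_lt_iff₀ hrA]
    refine lt_of_le_of_lt hw ?_
    rw [hA]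
    have : r * ((2 * n + 1) / η) * η = r * (2 * n + 1) := by field_simp
    rw [this]
    nlinarith
  have hz0 : z ≠ 0 := by
    rintro h0
    rw [h0, zero_sub, norm_neg] at hzu
    exact absurd hzu (not_lt.2 (min_le_right _ _))
  have hΩz : |Ω u0| / 2 ≤ ε * Ω z := by
    have h1 := hδΩ (show dist z u0 < δ by
      rw [dist_eq_norm]; exact hzu.trans_le (min_le_left _ _))
    rw [Real.dist_eq] at h1
    have h2 : |ε * (Ω z - Ω u0)| < |Ω u0| / 2 := by rwa [abs_mul, hε, one_mul]
    have h3 := (abs_lt.1 h2).1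
    rw [mul_sub, hεΩ] at h3
    linarith
  have hnz : ‖z‖ ≤ 2 * ‖u0‖ := by
    have : ‖z‖ ≤ ‖z - u0‖ + ‖u0‖ := by simpa using norm_add_le (z - u0) u0
    have h2 : η ≤ ‖u0‖ := min_le_right _ _
    linarith
  have hnz0 : 0 < ‖z‖ := norm_pos_iff.2 hz0
  rw [hxy, hΩhom _ hrA z hz0, norm_smul, Real.norm_of_nonneg hrA.le, ← mul_div_assoc, div_div,
    ← mul_pow]
  apply div_le_div₀ (le_trans (by positivity) hΩz) hΩz (by positivity)
  apply pow_le_pow_left₀ (by positivity)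
  nlinarith [mul_le_mul_of_nonneg_left hnz hrA.le]

theorem aux_pointwise (n : ℕ) (Ω : En n → ℝ)
    (hΩc : ContinuousOn Ω {(0 : En n)}ᶜ) (c c' : En n) (r : ℝ)
    (hne : ∀ x ∈ cube c r, x ∉ ccube c' r)
    (T : (En n → ℂ) → (En n → ℂ)) (b : En n → ℝ) (hb : LocallyIntegrable b volume)
    (hT : ∀ f : En n → ℂ, Integrable f → HasCompactSupport f →
          ∀ᵐ x : En n, x ∉ tsupport f →
            T f x = ∫ y, ((Ω (x - y) / ‖x - y‖ ^ n : ℝ) : ℂ) * f y)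
    (F : Set (En n)) (hF : MeasurableSet F) (hFs : F ⊆ cube c' r) :
    ∀ᵐ x : En n, x ∈ cube c r →
      IntegrableOn (fun y => (b x - b y) * (Ω (x - y) / ‖x - y‖ ^ n)) F ∧
      (b x : ℂ) * T (F.indicator fun _ => 1) x
        - T (fun y => (b y : ℂ) * F.indicator (fun _ => 1) y) x
        = ((∫ y in F, (b x - b y) * (Ω (x - y) / ‖x - y‖ ^ n) : ℝ) : ℂ) := by
  have hFc : F ⊆ ccube c' r := hFs.trans (aux_cube_subset_ccube _ _)
  have hcomp := aux_isCompact_ccube c' r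
  have hFfin : volume F ≠ ∞ := ((measure_mono hFc).trans_lt hcomp.measure_lt_top).ne
  have hbF : IntegrableOn b (ccube c' r) := hb.integrableOn_isCompact hcomp
  have hf1 : Integrable (F.indicator (fun _ => (1 : ℂ))) :=
    (integrable_indicator_iff hF).2 (integrableOn_const hFfin)
  have eq2 : (fun y => (b y : ℂ) * F.indicator (fun _ => (1 : ℂ)) y) =
      F.indicator (fun y => (b y : ℂ)) := by
    ext y; by_cases hy : y ∈ F <;> simp [hy]
  have hf2 : Integrable (F.indicator (fun y => (b y : ℂ))) :=
    (integrable_indicator_iff hF).2 (hbF.mono_set hFc).ofReal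
  have hts : ∀ g : En n → ℂ, tsupport (F.indicator g) ⊆ ccube c' r := fun g =>
    closure_minimal (support_indicator_subset.trans hFc) (aux_isClosed_ccube _ _)
  have hcs : ∀ g : En n → ℂ, HasCompactSupport (F.indicator g) := fun g =>
    hcomp.of_isClosed_subset (isClosed_tsupport _) (hts g)
  rw [eq2]
  filter_upwards [hT _ hf1 (hcs _), hT _ hf2 (hcs _)] with x h1 h2 hx
  have hx' := hne x hx
  rw [h1 (fun h => hx' (hts _ h)), h2 (fun h => hx' (hts _ h))]
  have hKc : ContinuousOn (fun y => Ω (x - y) / ‖x - y‖ ^ n) (ccube c' r) := by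
    have hsub : ∀ y ∈ ccube c' r, x - y ≠ 0 := fun y hy h =>
      hx' (by rw [sub_eq_zero.1 h]; exact hy)
    refine ContinuousOn.div ?_ (by fun_prop) ?_
    · exact hΩc.comp (by fun_prop) (fun y hy => hsub y hy)
    · intro y hy
      exact pow_ne_zero _ (norm_ne_zero_iff.2 (hsub y hy))
  have hK1 : IntegrableOn (fun y => Ω (x - y) / ‖x - y‖ ^ n) F :=
    (hKc.integrableOn_compact hcomp).mono_set hFc
  have hK2 : IntegrableOn (fun y => b y * (Ω (x - y) / ‖x - y‖ ^ n)) F :=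
    (hbF.mul_continuousOn hKc hcomp).mono_set hFc
  have e1 : (∫ y, ((Ω (x - y) / ‖x - y‖ ^ n : ℝ) : ℂ) * F.indicator (fun _ => (1 : ℂ)) y) =
      ((∫ y in F, Ω (x - y) / ‖x - y‖ ^ n : ℝ) : ℂ) := by
    rw [← integral_complex_ofReal, ← integral_indicator hF]
    congr 1; ext y; by_cases hy : y ∈ F <;> simp [hy]
  have e2 : (∫ y, ((Ω (x - y) / ‖x - y‖ ^ n : ℝ) : ℂ) * F.indicator (fun y => (b y : ℂ)) y) =
      ((∫ y in F, b y * (Ω (x - y) / ‖x - y‖ ^ n) : ℝ) : ℂ) := by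
    rw [← integral_complex_ofReal, ← integral_indicator hF]
    congr 1; ext y; by_cases hy : y ∈ F <;> simp [hy, mul_comm]
  rw [e1, e2]
  have e3 : (fun y => (b x - b y) * (Ω (x - y) / ‖x - y‖ ^ n)) =
      fun y => b x * (Ω (x - y) / ‖x - y‖ ^ n) - b y * (Ω (x - y) / ‖x - y‖ ^ n) := by
    ext y; ring
  rw [e3]
  refine ⟨(hK1.const_mul _).sub hK2, ?_⟩
  rw [integral_sub (hK1.const_mul _) hK2, integral_const_mul]
  push_cast
  ring

/-- one half of the main estimate -/
theorem aux_half (n : ℕ) (hn : 0 < n) (p q : ℝ) (hp : 1 ≤ p) (hq1 : 1 < q)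
    (Ω : En n → ℝ) (hΩc : ContinuousOn Ω {(0 : En n)}ᶜ) (c c' : En n) (r c0 ε : ℝ)
    (hr : 0 < r) (hc0 : 0 < c0) (hε : |ε| = 1)
    (hK : ∀ x ∈ cube c r, ∀ y ∈ ccube c' r, c0 / r ^ n ≤ ε * (Ω (x - y) / ‖x - y‖ ^ n))
    (T : (En n → ℂ) → (En n → ℂ)) (b : En n → ℝ) (hb : LocallyIntegrable b volume)
    (hT : ∀ f : En n → ℂ, Integrable f → HasCompactSupport f →
          ∀ᵐ x : En n, x ∉ tsupport f →
            T f x = ∫ y, ((Ω (x - y) / ‖x - y‖ ^ n : ℝ) : ℂ) * f y)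
    (M : ℝ) (hM : 0 ≤ M)
    (hbd : ∀ f : En n → ℂ, Measurable f → (∃ D : ℝ, ∀ x, ‖f x‖ ≤ D) →
          (∃ (c : En n) (r : ℝ), 0 < r ∧ ∀ x, x ∉ cube c r → f x = 0) →
          weakLpNorm q (fun x => (b x : ℂ) * T f x - T (fun y => (b y : ℂ) * f y) x) ≤
            ENNReal.ofReal M * eLpNorm f (ENNReal.ofReal p) volume)
    (F E : Set (En n)) (hF : MeasurableSet F) (hFs : F ⊆ cube c' r)
    (hFv : ENNReal.ofReal ((2 * r) ^ n) / 2 ≤ volume F)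
    (hE : MeasurableSet E) (hEs : E ⊆ cube c r) (σ m : ℝ) (hσ : |σ| = 1)
    (hbF : ∀ᵐ y, y ∈ F → σ * b y ≤ σ * m) (hbE : ∀ᵐ x, x ∈ E → σ * m ≤ σ * b x) :
    ∫⁻ x in E, ENNReal.ofReal (c0 * 2 ^ n / 2 * |b x - m|) ≤
      ENNReal.ofReal (q / (q - 1) * (M * ((2 * r) ^ n) ^ (1 / p)) *
        ((2 * r) ^ n) ^ (1 - 1 / q)) := by
  have hp0 : 0 < p := by linarith
  have hq0 : 0 < q := by linarith
  have hvpos : (0 : ℝ) < (2 * r) ^ n := by positivity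
  have hFfin : volume F ≠ ∞ := by
    refine ((measure_mono hFs).trans_lt ?_).ne
    rw [aux_volume_cube _ hr]; exact ENNReal.ofReal_lt_top
  have hFle : volume F ≤ ENNReal.ofReal ((2 * r) ^ n) := by
    rw [← aux_volume_cube c' hr]; exact measure_mono hFs
  have hFreal : (2 * r) ^ n / 2 ≤ (volume F).toReal := by
    have := ENNReal.toReal_mono hFfin hFv
    rwa [ENNReal.toReal_div, ENNReal.toReal_ofReal hvpos.le] at this
  have hne : ∀ x ∈ cube c r, x ∉ ccube c' r := by
    intro x hx hx'
    have := hK x hx x hx'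
    rw [sub_self, norm_zero, zero_pow hn.ne', _root_.div_zero, mul_zero] at this
    exact absurd this (not_le.2 (by positivity))
  have hpt := aux_pointwise n Ω hΩc c c' r hne T b hb hT F hF hFs
  set f : En n → ℂ := F.indicator (fun _ => 1) with hf
  set G : En n → ℂ := fun x => (b x : ℂ) * T f x - T (fun y => (b y : ℂ) * f y) x with hG
  have hlow : ∀ᵐ x, x ∈ E → c0 * 2 ^ n / 2 * |b x - m| ≤ ‖G x‖ := by
    filter_upwards [hpt, hbE] with x hx hxE hxm
    obtain ⟨hint, heq⟩ := hx (hEs hxm)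
    have hxE' := hxE hxm
    have habs : |b x - m| = σ * (b x - m) := by
      have h0 : 0 ≤ σ * (b x - m) := by rw [mul_sub]; linarith
      rw [← abs_of_nonneg h0, abs_mul, hσ, one_mul]
    have hge : c0 / r ^ n * |b x - m| * (volume F).toReal ≤
        σ * ε * ∫ y in F, (b x - b y) * (Ω (x - y) / ‖x - y‖ ^ n) := by
      rw [← integral_const_mul]
      have : c0 / r ^ n * |b x - m| * (volume F).toReal =
          ∫ y in F, c0 / r ^ n * |b x - m| := by
        rw [setIntegral_const, smul_eq_mul, Measure.real, mul_comm]
      rw [this]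
      refine setIntegral_mono_on_ae (integrableOn_const hFfin) (hint.const_mul _) hF ?_
      filter_upwards [hbF] with y hy hyF
      have h1 := hK x (hEs hxm) y (aux_cube_subset_ccube _ _ (hFs hyF))
      have h2 : |b x - m| ≤ σ * (b x - b y) := by
        rw [habs, mul_sub, mul_sub]; linarith [hy hyF]
      calc c0 / r ^ n * |b x - m| ≤ (ε * (Ω (x - y) / ‖x - y‖ ^ n)) * (σ * (b x - b y)) :=
            mul_le_mul h1 h2 (abs_nonneg _) (le_trans (by positivity) h1)
        _ = _ := by ring
    have hGx : ‖G x‖ = |∫ y in F, (b x - b y) * (Ω (x - y) / ‖x - y‖ ^ n)| := by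
      rw [hG]; simp only []
      rw [heq, Complex.norm_real, Real.norm_eq_abs]
    rw [hGx]
    calc c0 * 2 ^ n / 2 * |b x - m| = c0 / r ^ n * |b x - m| * ((2 * r) ^ n / 2) := by
          rw [mul_pow]; field_simp
      _ ≤ c0 / r ^ n * |b x - m| * (volume F).toReal := by gcongr
      _ ≤ _ := hge
      _ ≤ |σ * ε * ∫ y in F, (b x - b y) * (Ω (x - y) / ‖x - y‖ ^ n)| := le_abs_self _
      _ = _ := by rw [abs_mul, abs_mul, hσ, hε]; ring
  have hweak : weakLpNorm q G ≤ ENNReal.ofReal (M * ((2 * r) ^ n) ^ (1 / p)) := by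
    refine (hbd f (measurable_const.indicator hF) ⟨1, fun x => ?_⟩ ⟨c', r, hr, fun x hx => ?_⟩).trans ?_
    · by_cases hx : x ∈ F <;> simp [hf, hx]
    · exact indicator_of_notMem (fun h => hx (hFs h)) _
    · rw [ENNReal.ofReal_mul hM]
      gcongr
      refine (eLpNorm_indicator_const_le _ _).trans ?_
      rw [enorm_one, one_mul, ENNReal.toReal_ofReal hp0.le,
        ← ENNReal.ofReal_rpow_of_nonneg hvpos.le (by positivity)]
      gcongr
  have hbm : AEStronglyMeasurable b volume := hb.aestronglyMeasurable
  refine aux_kolmogorov (volume.restrict E) (fun x => c0 * 2 ^ n / 2 * |b x - m|)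
    (fun x => by positivity) ?_ q _ _ hq1 (by positivity) hvpos ?_ ?_
  · have : AEMeasurable b (volume.restrict E) := hbm.aemeasurable.restrict
    exact ((this.sub_const m).abs).const_mul _
  · rw [Measure.restrict_apply_univ, ← aux_volume_cube c hr]
    exact measure_mono hEs
  · intro t ht
    refine le_trans ?_ hweak
    refine le_trans ?_ (le_iSup₂ (f := fun (t : ℝ) (_ : 0 < t) =>
      ENNReal.ofReal t * volume {x : En n | t < ‖G x‖} ^ (1 / q)) t ht)
    gcongr ENNReal.ofReal t * ?_ ^ (1 / q)
    rw [Measure.restrict_apply' hE]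
    refine measure_mono_ae ?_
    filter_upwards [hlow] with x hx hx2
    exact lt_of_lt_of_le hx2.1 (hx hx2.2)

theorem aux_intOn {n : ℕ} (b : En n → ℝ) (hb : LocallyIntegrable b volume) (c : En n) (r : ℝ) :
    IntegrableOn b (cube c r) :=
  (hb.integrableOn_isCompact (aux_isCompact_ccube c r)).mono_set (aux_cube_subset_ccube _ _)

theorem aux_cube_ne_top {n : ℕ} (c : En n) {r : ℝ} (hr : 0 < r) : volume (cube c r) ≠ ∞ := by
  rw [aux_volume_cube c hr]; exact ENNReal.ofReal_ne_top

theorem aux_cube_toReal {n : ℕ} (c : En n) {r : ℝ} (hr : 0 < r) :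
    (volume (cube c r)).toReal = (2 * r) ^ n := by
  rw [aux_volume_cube c hr, ENNReal.toReal_ofReal (by positivity)]

theorem aux_intOn_sub {n : ℕ} (b : En n → ℝ) (hb : LocallyIntegrable b volume) (c : En n) {r : ℝ}
    (hr : 0 < r) (k : ℝ) : IntegrableOn (fun x => b x - k) (cube c r) :=
  (aux_intOn b hb c r).sub (integrableOn_const (aux_cube_ne_top c hr))

theorem aux_avg {n : ℕ} (b : En n → ℝ) (hb : LocallyIntegrable b volume) (c : En n) {r : ℝ}
    (hr : 0 < r) (k : ℝ) (A : Set (En n)) (hA : A ⊆ cube c r)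
    (hA0 : 0 < (volume A).toReal) :
    |(∫ x in A, b x) / (volume A).toReal - k| ≤
      (∫ x in cube c r, |b x - k|) / (volume A).toReal := by
  have hAfin : volume A ≠ ∞ := ((measure_mono hA).trans_lt (aux_cube_ne_top c hr).lt_top).ne
  have e : (∫ x in A, b x) / (volume A).toReal - k =
      (∫ x in A, (b x - k)) / (volume A).toReal := by
    rw [integral_sub ((aux_intOn b hb c r).mono_set hA) (integrableOn_const hAfin),
      setIntegral_const, smul_eq_mul, Measure.real]
    field_simp
  rw [e, abs_div, abs_of_pos hA0]
  gcongr
  refine (abs_integral_le_integral_abs).trans ?_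
  exact setIntegral_mono_set (aux_intOn_sub b hb c hr k).abs
    (Eventually.of_forall fun x => abs_nonneg _) hA.eventuallyLE

theorem aux_osc (n : ℕ) (hn : 0 < n) (p q : ℝ) (hp : 1 ≤ p) (hq1 : 1 < q)
    (Ω : En n → ℝ) (hΩc : ContinuousOn Ω {(0 : En n)}ᶜ) (c c' : En n) (r c0 ε : ℝ)
    (hr : 0 < r) (hc0 : 0 < c0) (hε : |ε| = 1)
    (hK : ∀ x ∈ cube c r, ∀ y ∈ ccube c' r, c0 / r ^ n ≤ ε * (Ω (x - y) / ‖x - y‖ ^ n))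
    (T : (En n → ℂ) → (En n → ℂ)) (b : En n → ℝ) (hb : LocallyIntegrable b volume)
    (hT : ∀ f : En n → ℂ, Integrable f → HasCompactSupport f →
          ∀ᵐ x : En n, x ∉ tsupport f →
            T f x = ∫ y, ((Ω (x - y) / ‖x - y‖ ^ n : ℝ) : ℂ) * f y)
    (M : ℝ) (hM : 0 ≤ M)
    (hbd : ∀ f : En n → ℂ, Measurable f → (∃ D : ℝ, ∀ x, ‖f x‖ ≤ D) →
          (∃ (c : En n) (r : ℝ), 0 < r ∧ ∀ x, x ∉ cube c r → f x = 0) →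
          weakLpNorm q (fun x => (b x : ℂ) * T f x - T (fun y => (b y : ℂ) * f y) x) ≤
            ENNReal.ofReal M * eLpNorm f (ENNReal.ofReal p) volume) :
    ∫ x in cube c r, |b x - cubeAvg b c r| ≤
      4 / (c0 * 2 ^ n / 2) * (q / (q - 1) * (M * ((2 * r) ^ n) ^ (1 / p)) *
        ((2 * r) ^ n) ^ (1 - 1 / q)) := by
  set W := q / (q - 1) * (M * ((2 * r) ^ n) ^ (1 / p)) * ((2 * r) ^ n) ^ (1 - 1 / q) with hW
  have hq1' : 0 < q - 1 := by linarith
  have hq0 : 0 < q := by linarith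
  have hW0 : 0 ≤ W := by positivity
  set c1 := c0 * 2 ^ n / 2 with hc1
  have hc1pos : 0 < c1 := by positivity
  have hvpos : (0 : ℝ) < (2 * r) ^ n := by positivity
  have hbm : AEMeasurable b volume := hb.aestronglyMeasurable.aemeasurable
  set b₁ := hbm.mk b with hb₁
  have hb₁m : Measurable b₁ := hbm.measurable_mk
  have hbb : b =ᵐ[volume] b₁ := hbm.ae_eq_mk
  set ν : Measure ℝ := (volume.restrict (cube c' r)).map b₁ with hν
  have hνap : ∀ S : Set ℝ, MeasurableSet S → ν S = volume (cube c' r ∩ b₁ ⁻¹' S) := by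
    intro S hS
    rw [hν, Measure.map_apply hb₁m hS, Measure.restrict_apply (hb₁m hS), inter_comm]
  have hνu : ν univ = ENNReal.ofReal ((2 * r) ^ n) := by
    rw [hνap _ MeasurableSet.univ, preimage_univ, inter_univ, aux_volume_cube c' hr]
  have : IsFiniteMeasure ν := ⟨by rw [hνu]; exact ENNReal.ofReal_lt_top⟩
  obtain ⟨m, hm1, hm2⟩ := aux_median ν (by rw [hνu]; simpa using hvpos)
  rw [hνu, hνap _ measurableSet_Iic] at hm1
  rw [hνu, hνap _ measurableSet_Ici] at hm2
  have hQ := aux_measurableSet_cube c r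
  have hQ' := aux_measurableSet_cube c' r
  have h1 := aux_half n hn p q hp hq1 Ω hΩc c c' r c0 ε hr hc0 hε hK T b hb hT M hM hbd
    (cube c' r ∩ b₁ ⁻¹' Iic m) (cube c r ∩ b₁ ⁻¹' Ici m)
    (hQ'.inter (hb₁m measurableSet_Iic)) inter_subset_left hm1
    (hQ.inter (hb₁m measurableSet_Ici)) inter_subset_left 1 m (by simp)
    (by filter_upwards [hbb] with y hy hyF; rw [hy]; simpa using hyF.2)
    (by filter_upwards [hbb] with y hy hyF; rw [hy]; simpa using hyF.2)
  have h2 := aux_half n hn p q hp hq1 Ω hΩc c c' r c0 ε hr hc0 hε hK T b hb hT M hM hbd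
    (cube c' r ∩ b₁ ⁻¹' Ici m) (cube c r ∩ b₁ ⁻¹' Iic m)
    (hQ'.inter (hb₁m measurableSet_Ici)) inter_subset_left hm2
    (hQ.inter (hb₁m measurableSet_Iic)) inter_subset_left (-1) m (by simp)
    (by filter_upwards [hbb] with y hy hyF; rw [hy]; simpa using hyF.2)
    (by filter_upwards [hbb] with y hy hyF; rw [hy]; simpa using hyF.2)
  rw [← hW, ← hc1] at h1 h2
  have hcov : cube c r ⊆ (cube c r ∩ b₁ ⁻¹' Ici m) ∪ (cube c r ∩ b₁ ⁻¹' Iic m) := by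
    intro x hx
    rcases le_total m (b₁ x) with h | h
    · exact Or.inl ⟨hx, h⟩
    · exact Or.inr ⟨hx, h⟩
  have h3 : ∫⁻ x in cube c r, ENNReal.ofReal (c1 * |b x - m|) ≤ ENNReal.ofReal (2 * W) := by
    calc _ ≤ _ := lintegral_mono_set hcov
      _ ≤ _ := lintegral_union_le _ _ _
      _ ≤ ENNReal.ofReal W + ENNReal.ofReal W := add_le_add h1 h2
      _ = _ := by rw [← ENNReal.ofReal_add hW0 hW0, two_mul]
  have hi := (aux_intOn_sub b hb c hr m).abs
  have h4 : c1 * ∫ x in cube c r, |b x - m| ≤ 2 * W := by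
    rw [← integral_const_mul]
    rw [← ofReal_integral_eq_lintegral_ofReal (hi.const_mul c1)
      (Eventually.of_forall fun x => by positivity)] at h3
    exact (ENNReal.ofReal_le_ofReal_iff (by positivity)).1 h3
  have h5 : |cubeAvg b c r - m| * (2 * r) ^ n ≤ ∫ x in cube c r, |b x - m| := by
    have := aux_avg b hb c hr m (cube c r) subset_rfl (by rw [aux_cube_toReal c hr]; exact hvpos)
    rw [← le_div_iff₀ hvpos]
    rw [aux_cube_toReal c hr] at this
    rwa [cubeAvg, aux_cube_toReal c hr]
  have h6 : ∫ x in cube c r, |b x - cubeAvg b c r| ≤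
      ∫ x in cube c r, (|b x - m| + |cubeAvg b c r - m|) := by
    refine integral_mono (aux_intOn_sub b hb c hr _).abs
      (hi.add (integrableOn_const (aux_cube_ne_top c hr))) fun x => ?_
    have := abs_sub_le (b x) m (cubeAvg b c r)
    rwa [abs_sub_comm m] at this
  rw [integral_add hi (integrableOn_const (aux_cube_ne_top c hr)), setIntegral_const, smul_eq_mul,
    Measure.real, aux_cube_toReal c hr] at h6
  rw [div_mul_eq_mul_div, le_div_iff₀ hc1pos]
  nlinarith [mul_le_mul_of_nonneg_left h5 hc1pos.le, mul_le_mul_of_nonneg_left h6 hc1pos.le]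

theorem aux_campanato (n : ℕ) (hn : 0 < n) (α : ℝ) (hα : 0 < α) (hα1 : α < 1) :
    ∃ C3 : ℝ, 0 < C3 ∧ ∀ (b : En n → ℝ) (N : ℝ), LocallyIntegrable b volume → 0 ≤ N →
      (∀ (c : En n) (r : ℝ), 0 < r →
        ∫ x in cube c r, |b x - cubeAvg b c r| ≤ N * ((2 * r) ^ n * (2 * r) ^ α)) →
      ∃ b' : En n → ℝ, lipSeminorm α b' ≤ ENNReal.ofReal (C3 * N) ∧ b =ᵐ[volume] b' := by
  set ρ : ℝ := (1 / 2 : ℝ) ^ α with hρ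
  have hρ0 : 0 < ρ := by positivity
  have hρ1 : ρ < 1 := Real.rpow_lt_one (by norm_num) (by norm_num) hα
  have hρ1' : 0 < 1 - ρ := by linarith
  set C3 : ℝ := 2 * (2 ^ n * 2 ^ α / (1 - ρ)) + 2 * (2 ^ n * 4 ^ α) with hC3
  have hC3pos : 0 < C3 := by positivity
  refine ⟨C3, hC3pos, fun b N hb hN h => ?_⟩
  -- comparing nested cubes
  have hnest : ∀ (x y : En n) (r : ℝ), 0 < r → cube y r ⊆ cube x (2 * r) →
      |cubeAvg b y r - cubeAvg b x (2 * r)| ≤ 2 ^ n * (4 * r) ^ α * N := by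
    intro x y r hr hsub
    have hv : 0 < (2 * r) ^ n := by positivity
    have h1 := aux_avg b hb x (by positivity : 0 < 2 * r) (cubeAvg b x (2 * r)) (cube y r) hsub
      (by rw [aux_cube_toReal y hr]; exact hv)
    rw [aux_cube_toReal y hr] at h1
    have h2 := h x (2 * r) (by positivity)
    rw [cubeAvg, aux_cube_toReal y hr]
    refine h1.trans ?_
    rw [div_le_iff₀ hv]
    refine h2.trans (le_of_eq ?_)
    rw [show 2 * (2 * r) = 4 * r by ring, show (4 * r) ^ n = 2 ^ n * (2 * r) ^ n by
      rw [← mul_pow]; congr 1; ring]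
    ring
  have hleb := IsUnifLocDoublingMeasure.ae_tendsto_average (volume : Measure (En n)) hb 1
  set G : Set (En n) := {x | ∀ r : ℝ, 0 < r →
    Tendsto (fun k : ℕ => cubeAvg b x (r * (1 / 2) ^ k)) atTop (𝓝 (b x))} with hG
  have hpow : ∀ r : ℝ, Tendsto (fun k : ℕ => r * (1 / 2 : ℝ) ^ k) atTop (𝓝 0) := fun r => by
    simpa using (tendsto_pow_atTop_nhds_zero_of_lt_one (by norm_num : (0 : ℝ) ≤ 1 / 2)
      (by norm_num)).const_mul r
  have hGae : ∀ᵐ x, x ∈ G := by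
    filter_upwards [hleb] with x hx r hr
    have hlim : Tendsto (fun k : ℕ => r * (1 / 2 : ℝ) ^ k / 2) atTop (𝓝[>] 0) := by
      refine tendsto_nhdsWithin_iff.2 ⟨?_, Eventually.of_forall fun k => ?_⟩
      · simpa using (hpow r).div_const 2
      · simp only [mem_Ioi]; positivity
    have h1 := hx (fun _ : ℕ => x) (fun k => r * (1 / 2 : ℝ) ^ k / 2) hlim
      (Eventually.of_forall fun k => by
        rw [Metric.mem_closedBall, dist_self]; positivity)
    set ω : ℝ := (volume (Metric.ball (0 : En n) 1)).toReal with hω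
    have hω0 : 0 < ω := ENNReal.toReal_pos (Metric.measure_ball_pos _ _ one_pos).ne'
      measure_ball_lt_top.ne
    have hd : ∀ s : ℝ, 0 < s → |(⨍ y in Metric.closedBall x (s / 2), b y) - cubeAvg b x s| ≤
        4 ^ n / ω * N * (2 * s) ^ α := by
      intro s hs
      have hvol : (volume (Metric.closedBall x (s / 2))).toReal = (s / 2) ^ n * ω := by
        rw [Measure.addHaar_closedBall _ _ (by positivity), ENNReal.toReal_mul,
          ENNReal.toReal_ofReal (by positivity)]
        simp [hω]
      have hvpos : 0 < (s / 2) ^ n * ω := by positivity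
      have hsub : Metric.closedBall x (s / 2) ⊆ cube x s := by
        intro y hy i
        have h1 := aux_abs_le (y - x) i
        rw [Metric.mem_closedBall, dist_eq_norm] at hy
        simp only [PiLp.sub_apply] at h1
        linarith
      have h2 := aux_avg b hb x hs (cubeAvg b x s) _ hsub (by rw [hvol]; exact hvpos)
      rw [hvol] at h2
      rw [setAverage_eq, Measure.real, hvol, smul_eq_mul, inv_mul_eq_div]
      refine h2.trans ?_
      rw [div_le_iff₀ hvpos]
      refine (h x s hs).trans (le_of_eq ?_)
      rw [show (2 * s) ^ n = 4 ^ n * (s / 2) ^ n by rw [← mul_pow]; congr 1; ring]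
      field_simp
    have h3 : Tendsto (fun k : ℕ => 4 ^ n / ω * N * (2 * (r * (1 / 2 : ℝ) ^ k)) ^ α) atTop (𝓝 0) := by
      have h4 : Tendsto (fun k : ℕ => 2 * (r * (1 / 2 : ℝ) ^ k)) atTop (𝓝 0) := by
        simpa using (hpow r).const_mul 2
      have h5 := h4.rpow_const (p := α) (Or.inr hα.le)
      rw [Real.zero_rpow hα.ne'] at h5
      simpa using h5.const_mul (4 ^ n / ω * N)
    have h6 := squeeze_zero_norm (f := fun k : ℕ =>
      (⨍ y in Metric.closedBall x (r * (1 / 2 : ℝ) ^ k / 2), b y) - cubeAvg b x (r * (1 / 2) ^ k))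
      (fun k => hd _ (by positivity)) h3
    simpa using h1.sub h6
  -- tail
  have htail : ∀ x ∈ G, ∀ r : ℝ, 0 < r →
      |cubeAvg b x r - b x| ≤ 2 ^ n * 2 ^ α / (1 - ρ) * N * r ^ α := by
    intro x hx r hr
    have h1 := dist_le_of_le_geometric_of_tendsto₀ (f := fun k : ℕ => cubeAvg b x (r * (1 / 2) ^ k))
      ρ (2 ^ n * (2 * r) ^ α * N) hρ1 (fun k => ?_) (hx r hr)
    · rw [Real.dist_eq] at h1
      simp only [pow_zero, mul_one] at h1
      refine h1.trans (le_of_eq ?_)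
      rw [Real.mul_rpow (by norm_num) hr.le]
      field_simp
    · rw [dist_comm, Real.dist_eq]
      have hs : 0 < r * (1 / 2 : ℝ) ^ (k + 1) := by positivity
      have h2 := hnest x x (r * (1 / 2 : ℝ) ^ (k + 1)) hs (fun y hy i =>
        (hy i).trans (by linarith))
      rw [show 2 * (r * (1 / 2 : ℝ) ^ (k + 1)) = r * (1 / 2) ^ k by rw [pow_succ]; ring] at h2
      refine h2.trans (le_of_eq ?_)
      rw [show 4 * (r * (1 / 2 : ℝ) ^ (k + 1)) = (2 * r) * (1 / 2) ^ k by rw [pow_succ]; ring,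
        Real.mul_rpow (by positivity) (by positivity), hρ, Real.rpow_pow_comm (by norm_num)]
      ring
  have hlip : ∀ x ∈ G, ∀ y ∈ G, |b x - b y| ≤ C3 * N * dist x y ^ α := by
    intro x hx y hy
    rcases eq_or_ne x y with rfl | hxy
    · simp [hα.ne']
    set r := dist x y with hr
    have hr0 : 0 < r := dist_pos.2 hxy
    have a1 := htail x hx r hr0
    have a2 := htail y hy r hr0
    have a3 := hnest x x r hr0 (fun z hz i => (hz i).trans (by linarith))
    have a4 := hnest x y r hr0 (fun z hz i => by
      have h1 := aux_abs_le (y - x) i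
      rw [← dist_eq_norm, dist_comm, ← hr, PiLp.sub_apply] at h1
      have h2 := abs_sub_le (z i) (y i) (x i)
      have h3 := hz i
      linarith)
    rw [Real.mul_rpow (by norm_num) hr0.le] at a3 a4
    rw [hC3]
    rw [abs_le] at a1 a2 a3 a4 ⊢
    constructor <;> nlinarith
  -- extension
  set K : NNReal := (C3 * N).toNNReal with hKdef
  let f : Metric.Snowflaking (En n) α hα hα1.le → ℝ := fun z => b z.ofSnowflaking
  have hfl : LipschitzOnWith K f {z | z.ofSnowflaking ∈ G} := by
    refine LipschitzOnWith.of_dist_le_mul fun z hz w hw => ?_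
    rw [Real.dist_eq, hKdef, Real.coe_toNNReal _ (by positivity)]
    have := hlip _ hz _ hw
    convert this using 2
    rw [← Metric.Snowflaking.dist_toSnowflaking_toSnowflaking (hα₀ := hα) (hα₁ := hα1.le)]
    simp
  obtain ⟨g, hg, hfg⟩ := hfl.extend_real
  refine ⟨fun x => g (Metric.Snowflaking.toSnowflaking x), ?_, ?_⟩
  · refine iSup_le fun x => iSup_le fun y => iSup_le fun hxy => ?_
    refine ENNReal.div_le_of_le_mul ?_
    have := hg (Metric.Snowflaking.toSnowflaking x) (Metric.Snowflaking.toSnowflaking y)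
    rw [Metric.Snowflaking.edist_toSnowflaking_toSnowflaking, edist_eq_enorm_sub] at this
    exact this
  · filter_upwards [hGae] with x hx
    have := hfg (show (Metric.Snowflaking.toSnowflaking x : Metric.Snowflaking (En n) α hα hα1.le) ∈
      {z : Metric.Snowflaking (En n) α hα hα1.le | z.ofSnowflaking ∈ G} by simpa using hx)
    simpa [f] using this

/-- If `0 < α < 1`, `1 ≤ p < n/α`, `1/q = 1/p - α/n`, and
`‖[b,T]f‖_{L^{q,∞}} ≤ M ‖f‖_{L^p}` for all bounded measurable `f` supported in a cube, then
`sup_Q |Q|^{-(1+α/n)} ∫_Q |b - b_Q| ≤ C M` with `C` depending only on `n, α, p, Ω`;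
consequently `b` agrees a.e. with a function of `Lip_α`-seminorm at most `C' M`. -/
theorem lip_of_commutator_weak_Lp_bound (n : ℕ) (α p q : ℝ) (hα : 0 < α) (hα1 : α < 1)
    (hp : 1 ≤ p) (hpn : p < n / α) (hq : 1 / q = 1 / p - α / n)
    (Ω : En n → ℝ)
    (hΩhom : ∀ l : ℝ, 0 < l → ∀ x : En n, x ≠ 0 → Ω (l • x) = Ω x)
    (hΩsmooth : ContDiffOn ℝ (⊤ : ℕ∞) Ω {(0 : En n)}ᶜ)
    (hΩne : ∃ x : En n, x ≠ 0 ∧ Ω x ≠ 0)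
    (hΩzero : ∫ θ : Metric.sphere (0 : En n) 1, Ω (θ : En n)
        ∂(volume : Measure (En n)).toSphere = 0) :
    ∃ C C' : ℝ, 0 < C ∧ 0 < C' ∧
      ∀ (T : (En n → ℂ) → (En n → ℂ)) (b : En n → ℝ) (M : ℝ),
        LocallyIntegrable b volume →
        (∀ f : En n → ℂ, Integrable f → HasCompactSupport f →
          ∀ᵐ x : En n, x ∉ tsupport f →
            T f x = ∫ y, ((Ω (x - y) / ‖x - y‖ ^ n : ℝ) : ℂ) * f y) →
        0 ≤ M →
        (∀ f : En n → ℂ, Measurable f → (∃ D : ℝ, ∀ x, ‖f x‖ ≤ D) →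
          (∃ (c : En n) (r : ℝ), 0 < r ∧ ∀ x, x ∉ cube c r → f x = 0) →
          weakLpNorm q (fun x => (b x : ℂ) * T f x - T (fun y => (b y : ℂ) * f y) x) ≤
            ENNReal.ofReal M * eLpNorm f (ENNReal.ofReal p) volume) →
        lipAvgNorm α b ≤ ENNReal.ofReal (C * M) ∧
        ∃ b' : En n → ℝ, lipSeminorm α b' ≤ ENNReal.ofReal (C' * M) ∧ b =ᵐ[volume] b' := by
  have hp0 : 0 < p := by linarith
  have hn : 0 < n := by
    rcases Nat.eq_zero_or_pos n with h0 | h0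
    · rw [h0] at hpn
      simp at hpn
      linarith
    · exact h0
  have hnR : (0 : ℝ) < n := by exact_mod_cast hn
  have hαn : α / n < 1 / p := by
    rw [div_lt_div_iff₀ hnR hp0]
    rw [lt_div_iff₀ hα] at hpn
    linarith
  have hαn0 : 0 < α / n := by positivity
  have h1p : 1 / p ≤ 1 := by rw [div_le_one hp0]; exact hp
  have hqi0 : 0 < 1 / q := by rw [hq]; linarith
  have hq0 : 0 < q := by simpa using hqi0
  have hq1 : 1 < q := by
    have : 1 / q < 1 := by rw [hq]; linarith
    rwa [div_lt_one hq0] at this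
  have hq1' : 0 < q - 1 := by linarith
  have hΩc : ContinuousOn Ω {(0 : En n)}ᶜ := hΩsmooth.continuousOn
  obtain ⟨u, c0, ε, hc0, hε, hK⟩ := aux_kernel n hn Ω hΩhom hΩc hΩne
  obtain ⟨C3, hC3, hcamp⟩ := aux_campanato n hn α hα hα1
  set C : ℝ := 4 / (c0 * 2 ^ n / 2) * (q / (q - 1)) with hC
  have hCpos : 0 < C := by positivity
  refine ⟨C, C3 * C, hCpos, by positivity, ?_⟩
  intro T b M hb hT hM hbd
  have hosc : ∀ (c : En n) (r : ℝ), 0 < r → ∫ x in cube c r, |b x - cubeAvg b c r| ≤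
      C * M * ((2 * r) ^ n) ^ (1 + α / n) := by
    intro c r hr
    have hv : (0 : ℝ) < (2 * r) ^ n := by positivity
    refine (aux_osc n hn p q hp hq1 Ω hΩc c (c - r • u) r c0 ε hr hc0 hε (hK c r hr) T b hb hT M hM
      hbd).trans (le_of_eq ?_)
    have : ((2 * r) ^ n) ^ (1 + α / n) = ((2 * r) ^ n) ^ (1 / p) * ((2 * r) ^ n) ^ (1 - 1 / q) := by
      rw [← Real.rpow_add hv, hq]
      congr 1
      ring
    rw [this, hC]
    ring
  constructor
  · refine iSup_le fun c => iSup_le fun r => iSup_le fun hr => ?_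
    have hv : (0 : ℝ) < (2 * r) ^ n := by positivity
    have h1 : ∫⁻ x in cube c r, (‖b x - cubeAvg b c r‖₊ : ℝ≥0∞) ≤
        ENNReal.ofReal (C * M * ((2 * r) ^ n) ^ (1 + α / n)) := by
      have h2 := ofReal_integral_norm_eq_lintegral_enorm (aux_intOn_sub b hb c hr (cubeAvg b c r))
      calc _ = _ := h2.symm
        _ ≤ _ := ENNReal.ofReal_le_ofReal (hosc c r hr)
    rw [aux_volume_cube c hr, ENNReal.ofReal_rpow_of_pos hv]
    calc _ ≤ ENNReal.ofReal (((2 * r) ^ n) ^ (-(1 + α / n))) *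
          ENNReal.ofReal (C * M * ((2 * r) ^ n) ^ (1 + α / n)) := by gcongr
      _ = ENNReal.ofReal (C * M) := by
          rw [← ENNReal.ofReal_mul (by positivity)]
          congr 1
          rw [Real.rpow_neg hv.le]
          field_simp
  · have := hcamp b (C * M) hb (by positivity) (fun c r hr => (hosc c r hr).trans (le_of_eq ?_))
    · rwa [← mul_assoc] at this
    · have h2r : 0 < 2 * r := by positivity
      rw [Real.rpow_add (by positivity), Real.rpow_one, ← Real.rpow_natCast (2 * r) n,
        ← Real.rpow_mul h2r.le, mul_div_cancel₀ _ hnR.ne']
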